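/- Let k be a field with separable algebraic closure k^sep, R a k-algebra with Jacobson radical Rad(R) = 0, and n ≥ 1 an integer. Assume that every element of R is algebraic over k of degree at most n, that every element of R ⊗_k k^sep is algebraic over k^sep of degree at most n, and that every family of nonzero pairwise orthogonal idempotents of R ⊗_k k^sep has length at most n. Then R is isomorphic as a k-algebra to a finite product Π_{i=1}^{s} M_{n_i}(E_i), where each E_i is a division k-algebra which is finite-dimensional over its center; in particular R is a semisimple ring. If moreover k is perfect, then R is finite-dimensional over k. -/

import Mathlib

open TensorProduct

/-- A Wedderburn decomposition of a `k`-algebra `R` : an isomorphism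
`R ≃ ∏ᵢ M_{nᵢ}(Eᵢ)` where each `Eᵢ` is a division `k`-algebra which is finite-dimensional
over its center. -/
structure WedderburnData (k : Type) [Field k] (R : Type) [Ring R] [Algebra k R] :
    Type 1 where
  s : ℕ
  n : Fin s → ℕ
  E : Fin s → Type
  [instDiv : ∀ i, DivisionRing (E i)]
  [instAlg : ∀ i, Algebra k (E i)]
  iso : R ≃ₐ[k] ∀ i, Matrix (Fin (n i)) (Fin (n i)) (E i)
  findimCenter : ∀ i, Module.Finite (Subring.center (E i)) (E i)

/-- In an algebraic algebra, a left ideal containing a non-nilpotent element contains a nonzero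
idempotent. -/
theorem Ideal.exists_isIdempotentElem_mem_of_not_isNilpotent {k R : Type*} [Field k] [Ring R]
    [Algebra k R] {I : Ideal R} {x : R} (hx : x ∈ I) (hnil : ¬ IsNilpotent x)
    (halg : IsAlgebraic k x) : ∃ e ∈ I, IsIdempotentElem e ∧ e ≠ 0 := by
  obtain ⟨p, hp, hpx⟩ := halg
  obtain ⟨q, hq, hndvd⟩ := Polynomial.exists_eq_pow_rootMultiplicity_mul_and_not_dvd p hp 0
  set m := p.rootMultiplicity 0
  simp only [map_zero, sub_zero] at hq hndvd
  rw [Polynomial.X_dvd_iff] at hndvd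
  obtain ⟨r, hr⟩ : Polynomial.X ∣ q - Polynomial.C (q.coeff 0) := by
    rw [Polynomial.X_dvd_iff]; simp
  set c := q.coeff 0
  set g : R := Polynomial.aeval x (-Polynomial.C c⁻¹ * r) with hg
  have hcomm : Commute x g := by
    have h := (Commute.all Polynomial.X (-Polynomial.C c⁻¹ * r)).map (Polynomial.aeval (R := k) x)
    rwa [Polynomial.aeval_X] at h
  have key : x ^ (m + 1) = x ^ (m + 1) * (x * g) := by
    have h1 : Polynomial.X ^ (m + 1) - Polynomial.X ^ (m + 1) *
        (Polynomial.X * (-Polynomial.C c⁻¹ * r)) = Polynomial.C c⁻¹ * Polynomial.X * p := by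
      have h2 : q = Polynomial.X * r + Polynomial.C c := by rw [← hr]; ring
      have h3 : Polynomial.C c⁻¹ * Polynomial.C c = (1 : Polynomial k) := by
        rw [← map_mul, inv_mul_cancel₀ hndvd, map_one]
      rw [hq, h2]
      linear_combination (-(Polynomial.X ^ (m + 1))) * h3
    have h4 := congrArg (Polynomial.aeval x) h1
    rwa [map_sub, map_mul, map_mul _ _ p, hpx, mul_zero, sub_eq_zero,
      map_mul _ Polynomial.X, map_pow, Polynomial.aeval_X] at h4
  have hpow : ∀ j : ℕ, x ^ (m + 1) * (x * g) ^ j = x ^ (m + 1) := by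
    intro j
    induction j with
    | zero => simp
    | succ j ih => rw [pow_succ' (x * g), ← mul_assoc, ← key, ih]
  have hfix := hpow (m + 1)
  refine ⟨(x * g) ^ (m + 1), ?_, ?_, fun h0 => hnil ⟨m + 1, ?_⟩⟩
  · rw [pow_succ, hcomm.eq, ← mul_assoc]
    exact I.mul_mem_left _ hx
  · change (x * g) ^ (m + 1) * (x * g) ^ (m + 1) = _
    have h5 : (x * g) ^ (m + 1) = g ^ (m + 1) * x ^ (m + 1) := by
      rw [hcomm.mul_pow, (hcomm.pow_pow (m + 1) (m + 1)).eq]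
    conv_lhs => rw [h5, mul_assoc, ← h5, hfix]
    exact h5.symm
  · rw [← hfix, h0, mul_zero]

/-- A nil left ideal is contained in the Jacobson radical. -/
theorem Ideal.le_jacobson_bot_of_forall_isNilpotent {R : Type*} [Ring R] {I : Ideal R}
    (h : ∀ x ∈ I, IsNilpotent x) : I ≤ Ideal.jacobson (⊥ : Ideal R) := by
  intro x hx
  rw [Ideal.mem_jacobson_iff]
  intro y
  obtain ⟨u, hu⟩ := (h _ (I.mul_mem_left y hx)).isUnit_one_add
  refine ⟨↑u⁻¹, ?_⟩
  have h1 : (↑u⁻¹ : R) * (1 + y * x) = 1 := by rw [← hu, Units.inv_mul]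
  rw [Ideal.mem_bot, mul_assoc, ← h1]
  noncomm_ring

/-- If every nonzero left ideal contains a nonzero idempotent and families of nonzero orthogonal
idempotents have bounded length, then the ring is semisimple. -/
theorem IsSemisimpleRing.of_orthogonal_idempotents_bounded {R : Type*} [Ring R] (n : ℕ)
    (hex : ∀ I : Ideal R, I ≠ ⊥ → ∃ e ∈ I, IsIdempotentElem e ∧ e ≠ 0)
    (hbdd : ∀ (m : ℕ) (e : Fin m → R), (∀ i, IsIdempotentElem (e i)) → (∀ i, e i ≠ 0) →
      (∀ i j, i ≠ j → e i * e j = 0) → m ≤ n) : IsSemisimpleRing R := by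
  refine { exists_isCompl := fun I => ?_ }
  let P : ℕ → Prop := fun m => ∃ e : Fin m → R, (∀ i, IsIdempotentElem (e i)) ∧ (∀ i, e i ≠ 0) ∧
    (∀ i j, i ≠ j → e i * e j = 0) ∧ ∀ i, e i ∈ I
  classical
  have hP0 : P 0 := ⟨Fin.elim0, fun i => i.elim0, fun i => i.elim0, fun i => i.elim0,
    fun i => i.elim0⟩
  have hP := Nat.findGreatest_spec (Nat.zero_le n) hP0
  have hmax : ∀ j, P j → j ≤ Nat.findGreatest P n := fun j hj =>
    Nat.le_findGreatest (hbdd j _ hj.choose_spec.1 hj.choose_spec.2.1 hj.choose_spec.2.2.1) hj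
  generalize Nat.findGreatest P n = m at hP hmax
  obtain ⟨e, hid, hne, horth, hmem⟩ := hP
  set E := ∑ i, e i with hE
  have hEe : ∀ i, E * e i = e i := fun i => by
    rw [hE, Finset.sum_mul, Finset.sum_eq_single i (fun j _ hj => horth j i hj) (by simp), hid i]
  have heE : ∀ i, e i * E = e i := fun i => by
    rw [hE, Finset.mul_sum, Finset.sum_eq_single i (fun j _ hj => horth i j hj.symm) (by simp),
      hid i]
  have hEE : E * E = E := by
    conv_lhs => rw [hE, Finset.sum_mul]
    exact Finset.sum_congr rfl fun i _ => heE i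
  have hEI : E ∈ I := I.sum_mem fun i _ => hmem i
  have hgen : ∀ x ∈ I, x * E = x := by
    by_contra! hcon
    obtain ⟨x, hx, hxE⟩ := hcon
    obtain ⟨f, hf, hff, hf0⟩ := hex (I ⊓ Ideal.span {1 - E}) (by
      intro h
      have : x * (1 - E) ∈ I ⊓ Ideal.span {1 - E} :=
        ⟨by rw [mul_sub, mul_one]; exact I.sub_mem hx (I.smul_mem _ hEI),
          Ideal.mul_mem_left _ _ (Ideal.subset_span rfl)⟩
      rw [h, Ideal.mem_bot, mul_sub, mul_one, sub_eq_zero] at this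
      exact hxE this.symm)
    obtain ⟨hfI, hfs⟩ := hf
    have hfE : f * E = 0 := by
      obtain ⟨a, ha⟩ := Ideal.mem_span_singleton'.1 hfs
      rw [← ha, mul_assoc, sub_mul, hEE, one_mul, sub_self, mul_zero]
    set f' := (1 - E) * f with hf'
    have hf'f : f * f' = f := by
      rw [hf', ← mul_assoc, mul_sub, mul_one, hfE, sub_zero, hff]
    have hf'E : f' * E = 0 := by rw [hf', mul_assoc, hfE, mul_zero]
    have hEf' : E * f' = 0 := by
      rw [hf', ← mul_assoc, mul_sub, mul_one, hEE, sub_self, zero_mul]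
    have hf'id : f' * f' = f' := by
      conv_lhs => rw [hf', mul_assoc, ← hf', hf'f]
    have hf'0 : f' ≠ 0 := fun h => hf0 (by rw [← hf'f, h, mul_zero])
    have hf'I : f' ∈ I := I.smul_mem _ hfI
    have h1 : ∀ i, e i * f' = 0 := fun i => by rw [← heE i, mul_assoc, hEf', mul_zero]
    have h2 : ∀ i, f' * e i = 0 := fun i => by rw [← hEe i, ← mul_assoc, hf'E, zero_mul]
    have : m + 1 ≤ m := hmax _ ⟨Fin.cons f' e, ?_, ?_, ?_, ?_⟩
    · omega
    · exact Fin.cases hf'id hid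
    · exact Fin.cases hf'0 hne
    · refine Fin.cases (Fin.cases (fun h => absurd rfl h) fun j _ => h2 j) fun i =>
        Fin.cases (fun _ => h1 i) fun j hij => horth i j fun h => hij (by rw [h])
    · exact Fin.cases hf'I hmem
  refine ⟨Ideal.span {1 - E}, ?_, ?_⟩
  · rw [Submodule.disjoint_def]
    intro x hx hxs
    obtain ⟨a, ha⟩ := Ideal.mem_span_singleton'.1 hxs
    rw [← hgen x hx, ← ha, mul_assoc, sub_mul, hEE, one_mul, sub_self, mul_zero]
  · rw [codisjoint_iff, Ideal.eq_top_iff_one, Submodule.mem_sup]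
    exact ⟨E, hEI, 1 - E, Ideal.subset_span rfl, by abel⟩

/-- Artin-style independence: left multiplication by a monoid `M` acting on a division ring `D`
turns a family that is independent over (a ring containing) the centralizer of `M` into a family of
functions `M → D` independent over `D`. -/
theorem LinearIndependent.mul_of_centralizer {D C M ι : Type*} [DivisionRing D] [Ring C]
    [Module C D] [Monoid M] (φ : M →* D)
    (hC : ∀ d : D, (∀ a, φ a * d = d * φ a) → ∃ c : C, ∀ x : D, c • x = d * x)
    {v : ι → D} (hv : LinearIndependent C v) :
    LinearIndependent D (fun (j : ι) (a : M) => φ a * v j) := by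
  classical
  rw [linearIndependent_iff'] at hv ⊢
  intro s
  induction s using Finset.induction_on with
  | empty => simp
  | insert i₀ s hi₀ ih =>
    intro g hg
    have hg' : ∀ a, ∑ i ∈ insert i₀ s, g i * (φ a * v i) = 0 := fun a => by
      simpa [Finset.sum_apply] using congrFun hg a
    by_cases h0 : g i₀ = 0
    · have := ih g (by rwa [Finset.sum_insert hi₀, h0, zero_smul, zero_add] at hg)
      intro i hi
      rcases Finset.mem_insert.1 hi with rfl | hi
      exacts [h0, this i hi]
    exfalso
    set h : ι → D := fun i => (g i₀)⁻¹ * g i with hh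
    have hh₀ : h i₀ = 1 := inv_mul_cancel₀ h0
    have hsum : ∀ a, ∑ i ∈ insert i₀ s, h i * (φ a * v i) = 0 := fun a => by
      simp only [hh, mul_assoc (g i₀)⁻¹]
      rw [← Finset.mul_sum, hg' a, mul_zero]
    have hcomm : ∀ i ∈ insert i₀ s, ∀ b, φ b * h i = h i * φ b := by
      intro i hi b
      rcases Finset.mem_insert.1 hi with rfl | hi
      · rw [hh₀, mul_one, one_mul]
      have := ih (fun i => h i * φ b - φ b * h i) (by
        ext a
        have h1 : ∑ i ∈ insert i₀ s, (h i * φ b - φ b * h i) * (φ a * v i) = 0 := by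
          have h2 : ∀ i, (h i * φ b - φ b * h i) * (φ a * v i) =
              h i * (φ (b * a) * v i) - φ b * (h i * (φ a * v i)) := fun i => by
            rw [map_mul]; noncomm_ring
          rw [Finset.sum_congr rfl fun i _ => h2 i, Finset.sum_sub_distrib, hsum,
            ← Finset.mul_sum, hsum, mul_zero, sub_zero]
        rw [Finset.sum_insert hi₀, hh₀, one_mul, mul_one, sub_self, zero_mul, zero_add] at h1
        simpa [Finset.sum_apply] using h1) i hi
      exact (sub_eq_zero.1 this).symm
    have hex : ∀ i, ∃ c : C, i ∈ insert i₀ s → ∀ x : D, c • x = h i * x := fun i => by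
      by_cases hi : i ∈ insert i₀ s
      · obtain ⟨c, hc⟩ := hC _ (hcomm i hi)
        exact ⟨c, fun _ => hc⟩
      · exact ⟨0, fun h => absurd h hi⟩
    choose c hc using hex
    have hmem := Finset.mem_insert_self i₀ s
    have hc0 : c i₀ = 0 := hv (insert i₀ s) c (by
      rw [Finset.sum_congr rfl fun i hi => hc i hi (v i)]
      simpa using hsum 1) i₀ hmem
    have := hc i₀ hmem 1
    rw [hc0, zero_smul, hh₀, mul_one] at this
    exact zero_ne_one this

/-- The centralizer of a subset of a division ring, as a division subring. -/
def Subfield.centralizerOf {D : Type*} [DivisionRing D] (s : Set D) : Subfield D :=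
  { Subring.centralizer s with inv_mem' := fun _ hx => Set.inv_mem_centralizer₀ hx }

theorem Subfield.mem_centralizerOf {D : Type*} [DivisionRing D] {s : Set D} {x : D} :
    x ∈ Subfield.centralizerOf s ↔ ∀ a ∈ s, a * x = x * a := Iff.rfl

/-- A division ring has dimension at most `[K : F]` over the centralizer of a finite
subextension `K / F`. -/
theorem Subfield.rank_centralizerOf_le {F K D : Type*} [Field F] [Field K] [DivisionRing D]
    [Algebra F K] [Algebra F D] [FiniteDimensional F K] (f : K →ₐ[F] D) :
    Module.rank (Subfield.centralizerOf (Set.range f)) D ≤ Module.finrank F K := by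
  refine rank_le fun s hs => ?_
  have hw := hs.mul_of_centralizer (f : K →* D) fun d hd =>
    ⟨⟨d, by rintro _ ⟨a, rfl⟩; exact hd a⟩, fun _ => rfl⟩
  let b := Module.finBasis F K
  let L : (Fin (Module.finrank F K) → D) →ₗ[D] (K → D) :=
    LinearMap.pi fun a => ∑ i, b.repr a i • LinearMap.proj i
  have hu : LinearIndependent D
      fun (j : s) (i : Fin (Module.finrank F K)) => f (b i) * (j : D) := by
    refine LinearIndependent.of_comp L ?_
    convert hw using 1
    ext j a
    simp only [L, Function.comp_apply, LinearMap.pi_apply, LinearMap.sum_apply,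
      LinearMap.smul_apply, LinearMap.proj_apply]
    have ha : f a = ∑ i, b.repr a i • f (b i) := by
      conv_lhs => rw [← b.sum_repr a, map_sum]
      exact Finset.sum_congr rfl fun i _ => map_smul f _ _
    simp only [MonoidHom.coe_coe, ha, Finset.sum_mul, smul_mul_assoc]
  simpa using hu.fintype_card_le_finrank

open MulOpposite in
/-- In a central division algebra `D` that is finite over a division subring `C`, the centralizer
of `C` has dimension at most `[D : C]`. -/
theorem LinearIndependent.card_le_finrank_of_commute {F D ι : Type*} [Field F]
    [DivisionRing D] [Algebra F D] [Algebra.IsCentral F D] (C : Subfield D) [Module.Finite C D]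
    [Fintype ι] {z : ι → D} (hz : LinearIndependent F z)
    (hcomm : ∀ i, ∀ c ∈ C, c * z i = z i * c) :
    Fintype.card ι ≤ Module.finrank C D := by
  have hz' : LinearIndependent F fun i => op (z i) :=
    hz.map' (opLinearEquiv F : D ≃ₗ[F] Dᵐᵒᵖ).toLinearMap (LinearEquiv.ker _)
  have hw := hz'.mul_of_centralizer (MonoidHom.id Dᵐᵒᵖ) fun d hd => by
    obtain ⟨a, rfl⟩ := (Algebra.IsCentral.mem_center_iff F (x := d)).1
      (Subalgebra.mem_center_iff.2 hd)
    exact ⟨a, fun x => Algebra.smul_def a x⟩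
  let b := Module.finBasis C D
  let L : (Fin (Module.finrank C D) → Dᵐᵒᵖ) →ₗ[Dᵐᵒᵖ] (Dᵐᵒᵖ → Dᵐᵒᵖ) :=
    { toFun := fun x y => ∑ l, op ((b.repr (unop y) l : D) * unop (x l))
      map_add' := fun x x' => by
        ext y; simp [mul_add, Finset.sum_add_distrib]
      map_smul' := fun g x => by
        ext y; simp [Finset.mul_sum, mul_assoc] }
  have hu : LinearIndependent Dᵐᵒᵖ
      fun (j : ι) (l : Fin (Module.finrank C D)) => op (z j * b l) := by
    refine LinearIndependent.of_comp L ?_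
    convert hw using 1
    swap
    · rfl
    ext j y
    apply unop_injective
    have : ∀ l, (b.repr (unop y) l : D) * (z j * b l) = z j * (b.repr (unop y) l • b l) := by
      intro l
      rw [← mul_assoc, hcomm j _ (b.repr (unop y) l).2, mul_assoc]; rfl
    simp only [L, Function.comp_apply, LinearMap.coe_mk, AddHom.coe_mk, unop_op, this]
    rw [← Finset.op_sum, unop_op, ← Finset.mul_sum, b.sum_repr]
    rfl
  simpa using hu.fintype_card_le_finrank

/-- Double centralizer: an element of the centralizer of a finite subextension `K` of a central
division algebra that commutes with the whole centralizer lies in `K`. -/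
theorem Subfield.mem_range_of_commute_centralizerOf {F K D : Type*} [Field F] [Field K]
    [DivisionRing D] [Algebra F K] [Algebra F D] [Algebra.IsCentral F D] [FiniteDimensional F K]
    (f : K →ₐ[F] D) {x : D}
    (hx : ∀ c ∈ Subfield.centralizerOf (Set.range f), c * x = x * c) : x ∈ Set.range f := by
  by_contra hxf
  have hrank := Subfield.rank_centralizerOf_le f
  have : Module.Finite (Subfield.centralizerOf (Set.range f)) D :=
    Module.rank_lt_aleph0_iff.1 (hrank.trans_lt (Cardinal.natCast_lt_aleph0))
  let b := Module.finBasis F K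
  have hb : LinearIndependent F (f ∘ b) :=
    b.linearIndependent.map' f.toLinearMap (LinearMap.ker_eq_bot.2 f.injective)
  have hcons : LinearIndependent F (Fin.cons x (f ∘ b) : Fin _ → D) := by
    refine linearIndependent_finCons.2 ⟨hb, fun hmem => hxf ?_⟩
    have : Submodule.span F (Set.range (f ∘ b)) ≤ LinearMap.range f.toLinearMap := by
      rw [Submodule.span_le]
      rintro _ ⟨i, rfl⟩
      exact ⟨b i, rfl⟩
    exact this hmem
  have h1 := hcons.card_le_finrank_of_commute (Subfield.centralizerOf (Set.range f))
    (Fin.cases hx fun i c hc => (hc _ ⟨b i, rfl⟩).symm)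
  have h2 := Module.finrank_le_of_rank_le hrank
  rw [Fintype.card_fin] at h1
  omega

/-- A separable field extension whose elements have bounded degree is finite. -/
theorem Algebra.IsSeparable.rank_le_of_bounded_degree {F E : Type*} [Field F] [Field E]
    [Algebra F E] [Algebra.IsSeparable F E] (n : ℕ)
    (h : ∀ x : E, ∃ p : Polynomial F, p ≠ 0 ∧ p.natDegree ≤ n ∧ Polynomial.aeval x p = 0) :
    Module.rank F E ≤ n := by
  refine rank_le fun s hs => ?_
  let M := IntermediateField.adjoin F (s : Set E)
  have : FiniteDimensional F M := IntermediateField.finiteDimensional_adjoin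
    fun x _ => Algebra.IsIntegral.isIntegral x
  obtain ⟨α, hα⟩ := Field.exists_primitive_element F M
  have hdeg : Module.finrank F M ≤ n := by
    rw [← (Field.primitive_element_iff_minpoly_natDegree_eq F α).1 hα]
    obtain ⟨p, hp, hpn, hpα⟩ := h α
    refine (Polynomial.natDegree_le_natDegree
      (minpoly.degree_le_of_ne_zero F α hp ?_)).trans hpn
    exact Subtype.ext (by simpa using hpα)
  refine le_trans ?_ hdeg
  have hs' : LinearIndependent F fun i : s =>
      (⟨i, IntermediateField.subset_adjoin F _ i.2⟩ : M) :=
    LinearIndependent.of_comp M.val.toLinearMap hs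
  simpa using hs'.fintype_card_le_finrank

universe u

/-- A separable element of a division algebra outside of the base field generates a nontrivial
finite separable field extension. -/
theorem IsSeparable.exists_field_algHom {K : Type u} {C : Type*} [Field K] [DivisionRing C]
    [Algebra K C] {b : C} (hsep : IsSeparable K b) (hb : b ∉ (algebraMap K C).range) :
    ∃ (M : Type u) (_ : Field M) (_ : Algebra K M), FiniteDimensional K M ∧
      Algebra.IsSeparable K M ∧ 2 ≤ Module.finrank K M ∧ Nonempty (M →ₐ[K] C) := by
  have hint : IsIntegral K b := hsep.isIntegral
  have hirr := minpoly.irreducible hint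
  have : Fact (Irreducible (minpoly K b)) := ⟨hirr⟩
  have hfin : FiniteDimensional K (AdjoinRoot (minpoly K b)) :=
    (AdjoinRoot.powerBasis hirr.ne_zero).finite
  refine ⟨AdjoinRoot (minpoly K b), inferInstance, inferInstance, hfin, ?_, ?_, ⟨?_⟩⟩
  · have hroot : IsSeparable K (AdjoinRoot.root (minpoly K b)) := by
      rw [IsSeparable, AdjoinRoot.minpoly_root hirr.ne_zero, (minpoly.monic hint).leadingCoeff]
      rwa [inv_one, map_one, mul_one]
    have htop : IntermediateField.adjoin K {AdjoinRoot.root (minpoly K b)} = ⊤ :=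
      IntermediateField.toSubalgebra_injective <| top_le_iff.1 <|
        (AdjoinRoot.adjoinRoot_eq_top (f := minpoly K b)).symm.le.trans
          (IntermediateField.algebra_adjoin_le_adjoin _ _)
    have := (IntermediateField.isSeparable_adjoin_simple_iff_isSeparable K _).2 hroot
    rw [htop] at this
    exact AlgEquiv.Algebra.isSeparable IntermediateField.topEquiv
  · exact ((minpoly.two_le_natDegree_iff hint).2 hb).trans_eq
      finrank_quotient_span_eq_natDegree.symm
  · exact Ideal.Quotient.liftₐ (Ideal.span {minpoly K b}) (Polynomial.aeval b) fun p hp => by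
      obtain ⟨q, rfl⟩ := Ideal.mem_span_singleton'.1 hp
      rw [map_mul, minpoly.aeval, mul_zero]

/-- A central division algebra containing a finite separable subextension that is not properly
contained in another one is finite over its center. -/
theorem Module.Finite.of_maximal_separable {F D : Type*} {K : Type u} [Field F] [Field K]
    [DivisionRing D] [Algebra F K] [Algebra F D] [Algebra.IsCentral F D]
    [Algebra.IsAlgebraic F D] [FiniteDimensional F K] (f : K →ₐ[F] D)
    (hmax : ∀ (M : Type u) [Field M] [Algebra F M] [Algebra K M] [IsScalarTower F K M]
      (_ : FiniteDimensional K M) (_ : Algebra.IsSeparable K M) (_ : M →ₐ[F] D),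
      Module.finrank K M < 2) :
    Module.Finite F D := by
  set C := Subfield.centralizerOf (Set.range f) with hC
  have hfC : ∀ a, f a ∈ C := fun a => by
    rintro _ ⟨b, rfl⟩
    rw [← map_mul, ← map_mul, mul_comm]
  let i : K →+* C := (f : K →+* D).codRestrict C hfC
  let : Algebra K C := i.toAlgebra' fun a c => Subtype.ext (c.2 _ ⟨a, rfl⟩)
  let : Algebra F C := (i.comp (algebraMap F K)).toAlgebra' fun a c =>
    Subtype.ext (c.2 _ ⟨algebraMap F K a, rfl⟩)
  have hFK : IsScalarTower F K C := IsScalarTower.of_algebraMap_eq fun _ => rfl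
  have hcoe : ∀ a, ((algebraMap F C a : C) : D) = algebraMap F D a := fun a => f.commutes a
  have hFC : IsScalarTower F C D := IsScalarTower.of_algebraMap_smul fun a x => by
    rw [Algebra.smul_def, ← hcoe]; rfl
  let j : C →ₐ[F] D := { C.subtype with commutes' := hcoe }
  have hfinD : Module.Finite C D :=
    Module.rank_lt_aleph0_iff.1
      ((Subfield.rank_centralizerOf_le f).trans_lt Cardinal.natCast_lt_aleph0)
  have hcentral : Algebra.IsCentral K C := ⟨fun x hx => by
    obtain ⟨a, ha⟩ := Subfield.mem_range_of_commute_centralizerOf f (x := (x : D)) fun c hc =>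
      congrArg Subtype.val (Subalgebra.mem_center_iff.1 hx ⟨c, hc⟩)
    exact ⟨a, Subtype.ext ha⟩⟩
  have halgF : Algebra.IsAlgebraic F C :=
    Algebra.IsAlgebraic.of_injective j Subtype.val_injective
  have halgK : Algebra.IsAlgebraic K C := Algebra.IsAlgebraic.tower_top (K := F) K
  have htop : (⊥ : Subalgebra K C) = ⊤ := by
    by_contra hne
    obtain ⟨b, hb, hsep⟩ := JacobsonNoether.exists_separable_and_not_isCentral' hne
    obtain ⟨M, _, _, hfin, hsepM, h2, ⟨g⟩⟩ := hsep.exists_field_algHom (K := K) hb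
    let : Algebra F M := ((algebraMap K M).comp (algebraMap F K)).toAlgebra
    have : IsScalarTower F K M := IsScalarTower.of_algebraMap_eq' rfl
    exact (hmax M hfin hsepM (j.comp (g.restrictScalars F))).not_ge h2
  have hfinC : Module.Finite K C := Module.Finite.of_surjective (Algebra.linearMap K C)
    fun x => Algebra.mem_bot.1 (htop ▸ Algebra.mem_top : x ∈ (⊥ : Subalgebra K C))
  have : Module.Finite F C := Module.Finite.trans K C
  exact Module.Finite.trans C D

/-- **Jacobson's theorem**: a division algebra that is algebraic of bounded degree over its center
is finite over its center. -/
theorem Algebra.IsCentral.finite_of_bounded_degree {F : Type u} {D : Type*} [Field F]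
    [DivisionRing D] [Algebra F D] [Algebra.IsCentral F D] (n : ℕ)
    (h : ∀ x : D, ∃ p : Polynomial F, p ≠ 0 ∧ p.natDegree ≤ n ∧ Polynomial.aeval x p = 0) :
    Module.Finite F D := by
  classical
  have halg : Algebra.IsAlgebraic F D := ⟨fun x => by
    obtain ⟨p, hp, -, hpx⟩ := h x
    exact ⟨p, hp, hpx⟩⟩
  let P : ℕ → Prop := fun m => ∃ (K : Type u) (_ : Field K) (_ : Algebra F K),
    FiniteDimensional F K ∧ Algebra.IsSeparable F K ∧ Nonempty (K →ₐ[F] D) ∧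
      Module.finrank F K = m
  have hbdd : ∀ m, P m → m ≤ n := by
    rintro m ⟨K, _, _, hfin, hsep, ⟨f⟩, rfl⟩
    have hinj : Function.Injective f := f.toRingHom.injective
    refine Module.finrank_le_of_rank_le
      (Algebra.IsSeparable.rank_le_of_bounded_degree n fun x => ?_)
    obtain ⟨p, hp, hpn, hpx⟩ := h (f x)
    refine ⟨p, hp, hpn, hinj ?_⟩
    rw [← Polynomial.aeval_algHom_apply, hpx, map_zero]
  have hP : P 1 := ⟨F, inferInstance, inferInstance, inferInstance, inferInstance,
    ⟨Algebra.ofId F D⟩, Module.finrank_self F⟩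
  have hspec := Nat.findGreatest_spec (hbdd 1 hP) hP
  have hmax : ∀ m, P m → m ≤ Nat.findGreatest P n := fun m hm =>
    Nat.le_findGreatest (hbdd m hm) hm
  generalize Nat.findGreatest P n = N at hspec hmax
  obtain ⟨K, _, _, hfin, hsep, ⟨f⟩, rfl⟩ := hspec
  refine Module.Finite.of_maximal_separable f fun M _ _ _ _ hfinM hsepM g => ?_
  have := hmax _ ⟨M, inferInstance, inferInstance, Module.Finite.trans K M,
    Algebra.IsSeparable.trans F K M, ⟨g⟩, rfl⟩
  rw [← Module.finrank_mul_finrank F K M] at this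
  have hpos : 0 < Module.finrank F K := Module.finrank_pos
  by_contra! h2
  nlinarith

/-- The structure map of an algebra, corestricted to the center. -/
def Subring.algebraMapCenter (k E : Type*) [CommRing k] [Ring E] [Algebra k E] :
    k →+* Subring.center E :=
  (algebraMap k E).codRestrict _ fun a =>
    Subring.mem_center_iff.2 fun x => (Algebra.commutes a x).symm

/-- A division algebra of bounded degree over any base field is finite over its center. -/
theorem DivisionRing.finite_center_of_bounded_degree {k E : Type*} [Field k] [DivisionRing E]
    [Algebra k E] (n : ℕ)
    (h : ∀ x : E, ∃ p : Polynomial k, p ≠ 0 ∧ p.natDegree ≤ n ∧ Polynomial.aeval x p = 0) :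
    Module.Finite (Subring.center E) E := by
  have : Algebra.IsCentral (Subring.center E) E :=
    ⟨fun x hx => ⟨⟨x, Subring.mem_center_iff.2 (Subalgebra.mem_center_iff.1 hx)⟩, rfl⟩⟩
  refine Algebra.IsCentral.finite_of_bounded_degree n fun x => ?_
  obtain ⟨p, hp, hpn, hpx⟩ := h x
  refine ⟨p.map (Subring.algebraMapCenter k E),
    (Polynomial.map_ne_zero_iff (RingHom.injective _)).2 hp,
    Polynomial.natDegree_map_le.trans hpn, ?_⟩
  rw [Polynomial.aeval_def, Polynomial.eval₂_map]
  exact hpx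

/-- A division algebra of bounded degree over a perfect field is finite-dimensional. -/
theorem DivisionRing.finiteDimensional_of_bounded_degree {k E : Type*} [Field k] [PerfectField k]
    [DivisionRing E] [Algebra k E] (n : ℕ)
    (h : ∀ x : E, ∃ p : Polynomial k, p ≠ 0 ∧ p.natDegree ≤ n ∧ Polynomial.aeval x p = 0) :
    FiniteDimensional k E := by
  have hE := DivisionRing.finite_center_of_bounded_degree n h
  let : Algebra k (Subring.center E) := (Subring.algebraMapCenter k E).toAlgebra
  have : IsScalarTower k (Subring.center E) E := IsScalarTower.of_algebraMap_eq fun _ => rfl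
  let j : Subring.center E →ₐ[k] E := { (Subring.center E).subtype with commutes' := fun _ => rfl }
  have hbdd : ∀ x : Subring.center E, ∃ p : Polynomial k,
      p ≠ 0 ∧ p.natDegree ≤ n ∧ Polynomial.aeval x p = 0 := fun x => by
    obtain ⟨p, hp, hpn, hpx⟩ := h x
    refine ⟨p, hp, hpn, Subtype.val_injective ?_⟩
    change j (Polynomial.aeval x p) = j 0
    rw [← Polynomial.aeval_algHom_apply, map_zero]
    exact hpx
  have : Algebra.IsAlgebraic k (Subring.center E) := ⟨fun x => by
    obtain ⟨p, hp, -, hpx⟩ := hbdd x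
    exact ⟨p, hp, hpx⟩⟩
  have : Module.Finite k (Subring.center E) := Module.rank_lt_aleph0_iff.1
    ((Algebra.IsSeparable.rank_le_of_bounded_degree n hbdd).trans_lt Cardinal.natCast_lt_aleph0)
  exact Module.Finite.trans (Subring.center E) E

/-- Let `k` be a field with separable closure `k^sep`, and `R` a
`k`-algebra with trivial Jacobson radical such that every element of `R`
(resp. `R ⊗ k^sep`) is algebraic of degree `≤ n`, and every family of nonzero pairwise
orthogonal idempotents of `R ⊗ k^sep` has length `≤ n`.  Then `R ≃ ∏ᵢ M_{nᵢ}(Eᵢ)` with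
`Eᵢ` division `k`-algebras finite-dimensional over their centers; in particular `R` is
semisimple, and if `k` is perfect then `R` is finite-dimensional over `k`. -/
theorem wedderburn_of_bounded_algebraic (k ksep R : Type) [Field k] [Field ksep]
    [Algebra k ksep] [IsSepClosure k ksep] [Ring R] [Algebra k R] (n : ℕ) (hn : 1 ≤ n)
    (hrad : Ideal.jacobson (⊥ : Ideal R) = ⊥)
    (halg : ∀ x : R, ∃ p : Polynomial k, p ≠ 0 ∧ p.natDegree ≤ n ∧ Polynomial.aeval x p = 0)
    (halgsep : ∀ x : ksep ⊗[k] R, ∃ p : Polynomial ksep,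
      p ≠ 0 ∧ p.natDegree ≤ n ∧ Polynomial.aeval x p = 0)
    (hidem : ∀ (m : ℕ) (e : Fin m → ksep ⊗[k] R),
      (∀ i, IsIdempotentElem (e i)) → (∀ i, e i ≠ 0) →
      (∀ i j, i ≠ j → e i * e j = 0) → m ≤ n) :
    Nonempty (WedderburnData k R) ∧ IsSemisimpleRing R ∧
      (PerfectField k → FiniteDimensional k R) := by
  have hss : IsSemisimpleRing R := by
    refine IsSemisimpleRing.of_orthogonal_idempotents_bounded n (fun I hI => ?_)
      fun m e hid hne horth => ?_
    · by_contra hno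
      refine hI (eq_bot_iff.2 (hrad ▸ Ideal.le_jacobson_bot_of_forall_isNilpotent fun x hx => ?_))
      by_contra hnil
      obtain ⟨p, hp, -, hpx⟩ := halg x
      exact hno (Ideal.exists_isIdempotentElem_mem_of_not_isNilpotent hx hnil ⟨p, hp, hpx⟩)
    · let ι : R →ₐ[k] ksep ⊗[k] R := Algebra.TensorProduct.includeRight
      have hι : Function.Injective ι :=
        Algebra.TensorProduct.includeRight_injective (algebraMap k ksep).injective
      refine hidem m (fun i => ι (e i)) (fun i => (hid i).map ι)
        (fun i h => hne i (hι (h.trans (map_zero ι).symm))) fun i j hij => ?_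
      rw [← map_mul, horth i j hij, map_zero]
  obtain ⟨s, E, d, instDiv, instAlg, hd, ⟨iso⟩⟩ :=
    IsSemisimpleRing.exists_algEquiv_pi_matrix_divisionRing k R
  have hbdd : ∀ i, ∀ x : E i, ∃ p : Polynomial k,
      p ≠ 0 ∧ p.natDegree ≤ n ∧ Polynomial.aeval x p = 0 := fun i x => by
    let σ : E i →ₐ[k] Matrix (Fin (d i)) (Fin (d i)) (E i) :=
      { Matrix.scalar (Fin (d i)) with commutes' := fun _ => rfl }
    let π : R →ₐ[k] Matrix (Fin (d i)) (Fin (d i)) (E i) :=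
      (Pi.evalAlgHom k (fun i => Matrix (Fin (d i)) (Fin (d i)) (E i)) i).comp (iso : R →ₐ[k] _)
    obtain ⟨y, hy⟩ : ∃ y, π y = σ x := by
      refine ⟨iso.symm (Pi.single i (σ x)), ?_⟩
      simp [π]
    obtain ⟨p, hp, hpn, hpy⟩ := halg y
    refine ⟨p, hp, hpn, ?_⟩
    have h1 : σ (Polynomial.aeval x p) = 0 := by
      rw [← Polynomial.aeval_algHom_apply, ← hy, Polynomial.aeval_algHom_apply, hpy, map_zero]
    have := hd i
    simpa [σ] using congrFun (congrFun h1 0) 0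
  refine ⟨⟨⟨s, d, E, iso, fun i => DivisionRing.finite_center_of_bounded_degree n (hbdd i)⟩⟩,
    hss, fun _ => ?_⟩
  have : ∀ i, FiniteDimensional k (E i) := fun i =>
    DivisionRing.finiteDimensional_of_bounded_degree n (hbdd i)
  exact Module.Finite.equiv iso.symm.toLinearEquiv
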